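/- arXiv:2507.11136 — 3 statements merged into one kernel-verified Lean document; each statement's English description precedes it below -/
import Mathlib

section
/- (Theorem 3.) Let W^(d) ∈ ℝ^{M_d×R} for d = 1, ..., D, let w = Σ_{r=1}^{R} w_r^(1) ⊗ ... ⊗ w_r^(D) be the CP vector built from the factor matrices, and let Φ = Φ^(1) ⊙ ... ⊙ Φ^(D) be the Khatri–Rao product of Φ^(k) ∈ ℝ^{M_k×N}. Fix d ∈ {1, ..., D} and define G^(d) := Φ^(d) ⊙ (⊛_{k≠d} W^(k)T Φ^(k)) ∈ ℝ^{M_d R × N}, where ⊛_{k≠d} is the Hadamard product over all k ≠ d of the R×N matrices W^(k)T Φ^(k). Then Φ^T w = vec(W^(d))^T G^(d), where vec(W^(d)) ∈ ℝ^{M_d R} is the column-wise vectorization of W^(d). -/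
open Matrix
open scoped BigOperators

/-- Theorem 3: For factor matrices `W⁽ᵏ⁾ ∈ ℝ^{M_k×R}`, the CP vector
`w = Σᵣ wᵣ⁽¹⁾ ⊗ ⋯ ⊗ wᵣ⁽ᴰ⁾` (encoded via multi-indices), and the Khatri–Rao feature
matrix `Φ = Φ⁽¹⁾ ⊙ ⋯ ⊙ Φ⁽ᴰ⁾`, fixing `d` and defining
`G⁽ᵈ⁾ := Φ⁽ᵈ⁾ ⊙ (⊛_{k≠d} W⁽ᵏ⁾ᵀ Φ⁽ᵏ⁾) ∈ ℝ^{M_d R × N}` (rows indexed by pairs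
`(r, m_d)`, consistently with the column-wise vectorization `vec(W⁽ᵈ⁾)_{(r,m)} = W⁽ᵈ⁾_{m,r}`),
we have `Φᵀ w = vec(W⁽ᵈ⁾)ᵀ G⁽ᵈ⁾`. -/
theorem cp_model_fit_design_matrix
    {D N R : ℕ} {M : Fin D → ℕ}
    (W : (k : Fin D) → Matrix (Fin (M k)) (Fin R) ℝ)
    (Φk : (k : Fin D) → Matrix (Fin (M k)) (Fin N) ℝ)
    (w : ((k : Fin D) → Fin (M k)) → ℝ)
    (hw : ∀ i, w i = ∑ r, ∏ k, W k (i k) r)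
    (Φ : Matrix ((k : Fin D) → Fin (M k)) (Fin N) ℝ)
    (hΦ : ∀ i n, Φ i n = ∏ k, Φk k (i k) n)
    (d : Fin D)
    (G : Matrix (Fin R × Fin (M d)) (Fin N) ℝ)
    (hG : ∀ p n, G p n = Φk d p.2 n * ∏ k ∈ Finset.univ.erase d, ((W k)ᵀ * Φk k) p.1 n)
    (vecW : Fin R × Fin (M d) → ℝ)
    (hvecW : ∀ p, vecW p = W d p.2 p.1) :
    ∀ n : Fin N, Φᵀ.mulVec w n = Gᵀ.mulVec vecW n := by
  intro n
  have hL : Φᵀ.mulVec w n = ∑ r, ∏ k, ((W k)ᵀ * Φk k) r n := by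
    simp only [mulVec, dotProduct, transpose_apply, mul_apply, hw, hΦ, Finset.prod_univ_sum,
      Fintype.piFinset_univ, Finset.mul_sum]
    rw [Finset.sum_comm]
    refine Finset.sum_congr rfl fun r _ => Finset.sum_congr rfl fun i _ => ?_
    rw [Finset.prod_mul_distrib, mul_comm]
  rw [hL]
  simp only [mulVec, dotProduct, transpose_apply, hG, hvecW, Fintype.sum_prod_type]
  refine Finset.sum_congr rfl fun r _ => ?_
  rw [← Finset.mul_prod_erase Finset.univ _ (Finset.mem_univ d), mul_apply, Finset.sum_mul]
  refine Finset.sum_congr rfl fun m _ => ?_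
  rw [transpose_apply]
  ring
end

section
/- Let W^(k) ∈ ℝ^{M_k×R} and Φ^(k) ∈ ℝ^{M_k×N} for k = 1, ..., D, fix d ∈ {1,...,D}, and define G^(d) := Φ^(d) ⊙ (⊛_{k≠d} W^(k)T Φ^(k)) ∈ ℝ^{M_d R × N}. Then G^(d) G^(d)T equals the reshaping into an M_d R × M_d R matrix of the M_d² × R² matrix (Φ^(d) ⊙ Φ^(d)) [⊛_{k≠d} (Φ^(k) ⊙ Φ^(k))^T (W^(k) ⊗ W^(k))]^T-free form; explicitly, G^(d) G^(d)T = R{ (Φ^(d) ⊙ Φ^(d)) ⊛_{k≠d} [ (Φ^(k) ⊙ Φ^(k))^T (W^(k) ⊗ W^(k)) ]^T }_{M_d R × M_d R}, where the Hadamard product ⊛_{k≠d} combines the N×R² matrices (Φ^(k) ⊙ Φ^(k))^T (W^(k) ⊗ W^(k)), the result is left-multiplied by Φ^(d) ⊙ Φ^(d) ∈ ℝ^{M_d²×N}, and R{·}_{M_d R × M_d R} reshapes the resulting M_d² × R² matrix into an M_d R × M_d R matrix by sending the entry at row index (m₁,m₂) and column index (r₁,r₂) to row index (r₁,m₁) and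 column index (r₂,m₂). -/
open Matrix
open scoped Kronecker BigOperators

/-- The column-wise Khatri–Rao product: the `n`-th column of `A ⊙ B` is the
Kronecker product of the `n`-th columns of `A` and `B`. -/
def khatriRao {I J N : Type*} (A : Matrix I N ℝ) (B : Matrix J N ℝ) :
    Matrix (I × J) N ℝ :=
  Matrix.of fun p n => A p.1 n * B p.2 n

/-- The mixed-product rule: `(A ⊙ B)ᵀ (V ⊗ W)` is, row by row, the Kronecker product of the rows
of `Aᵀ V` and `Bᵀ W`. -/
theorem khatriRao_transpose_mul_kronecker {I J N P Q : Type*} [Fintype I] [Fintype J]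
    (A : Matrix I N ℝ) (B : Matrix J N ℝ) (V : Matrix I P ℝ) (W : Matrix J Q ℝ)
    (n : N) (q : P × Q) :
    ((khatriRao A B)ᵀ * (V ⊗ₖ W)) n q = (Vᵀ * A) q.1 n * (Wᵀ * B) q.2 n := by
  simp only [Matrix.mul_apply, Matrix.transpose_apply, khatriRao, Matrix.of_apply,
    Matrix.kroneckerMap_apply, Fintype.sum_prod_type, Finset.sum_mul_sum]
  exact Finset.sum_congr rfl fun i _ => Finset.sum_congr rfl fun j _ => by ring

/-- For `W⁽ᵏ⁾ ∈ ℝ^{M_k×R}`, `Φ⁽ᵏ⁾ ∈ ℝ^{M_k×N}` and fixed `d`, with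
`G⁽ᵈ⁾ := Φ⁽ᵈ⁾ ⊙ (⊛_{k≠d} W⁽ᵏ⁾ᵀ Φ⁽ᵏ⁾)` (rows indexed by pairs `(r, m_d)`),
`G⁽ᵈ⁾ G⁽ᵈ⁾ᵀ` equals the reshaping into `M_d R × M_d R` of the `M_d² × R²` matrix
`(Φ⁽ᵈ⁾ ⊙ Φ⁽ᵈ⁾) ⊛_{k≠d} [(Φ⁽ᵏ⁾ ⊙ Φ⁽ᵏ⁾)ᵀ (W⁽ᵏ⁾ ⊗ W⁽ᵏ⁾)]`, where the reshape sends
the entry at row `(m₁,m₂)`, column `(r₁,r₂)` to row `(r₁,m₁)`, column `(r₂,m₂)`. -/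
theorem G_mul_G_transpose_reshape
    {D N R : ℕ} {M : Fin D → ℕ}
    (W : (k : Fin D) → Matrix (Fin (M k)) (Fin R) ℝ)
    (Φ : (k : Fin D) → Matrix (Fin (M k)) (Fin N) ℝ)
    (d : Fin D)
    (G : Matrix (Fin R × Fin (M d)) (Fin N) ℝ)
    (hG : ∀ p n, G p n = Φ d p.2 n * ∏ k ∈ Finset.univ.erase d, ((W k)ᵀ * Φ k) p.1 n)
    (H : Matrix (Fin (M d) × Fin (M d)) (Fin R × Fin R) ℝ)
    (hH : H = khatriRao (Φ d) (Φ d) *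
        Matrix.of (fun (n : Fin N) (q : Fin R × Fin R) =>
          ∏ k ∈ Finset.univ.erase d, ((khatriRao (Φ k) (Φ k))ᵀ * (W k ⊗ₖ W k)) n q)) :
    ∀ (r₁ r₂ : Fin R) (m₁ m₂ : Fin (M d)),
      (G * Gᵀ) (r₁, m₁) (r₂, m₂) = H (m₁, m₂) (r₁, r₂) := by
  intro r₁ r₂ m₁ m₂
  subst hH
  rw [Matrix.mul_apply, Matrix.mul_apply]
  refine Finset.sum_congr rfl fun n _ => ?_
  simp only [Matrix.transpose_apply, hG, Matrix.of_apply, khatriRao_transpose_mul_kronecker,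
    Finset.prod_mul_distrib]
  simp only [khatriRao, Matrix.of_apply]
  ring
end

section
/- Let W^(d) ∈ ℝ^{M_d×R} and Φ^(d) ∈ ℝ^{M_d×N} for d = 1, ..., D. Then the squared Frobenius norm of the row vector 1_R^T (⊛_{d=1}^{D} W^(d)T Φ^(d)) ∈ ℝ^{1×N} satisfies ‖1_R^T (⊛_{d=1}^{D} W^(d)T Φ^(d))‖²_F = 1_N^T ( ⊛_{d=1}^{D} (Φ^(d) ⊙ Φ^(d))^T (W^(d) ⊗ W^(d)) ) 1_{R²}, where the Hadamard product on the right combines D matrices of size N×R². -/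
open Matrix
open scoped Kronecker BigOperators

/-- The entries of `(A ⊙ B)ᵀ (V ⊗ W)` are products of entries of `Vᵀ A` and `Wᵀ B`. -/
theorem khatriRao_transpose_mul_kronecker_apply {I J N K L : Type*} [Fintype I] [Fintype J]
    (A : Matrix I N ℝ) (B : Matrix J N ℝ) (V : Matrix I K ℝ) (W : Matrix J L ℝ)
    (n : N) (q : K × L) :
    ((khatriRao A B)ᵀ * (V ⊗ₖ W)) n q = (Vᵀ * A) q.1 n * (Wᵀ * B) q.2 n := by
  simp only [Matrix.mul_apply, Matrix.transpose_apply, Matrix.kroneckerMap_apply, khatriRao,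
    Matrix.of_apply, Fintype.sum_mul_sum, Fintype.sum_prod_type]
  exact Finset.sum_congr rfl fun i _ => Finset.sum_congr rfl fun j _ => by ring

/-- For `W⁽ᵈ⁾ ∈ ℝ^{M_d×R}` and `Φ⁽ᵈ⁾ ∈ ℝ^{M_d×N}`, the squared
Frobenius norm of the row vector `1_Rᵀ (⊛_{d=1}^D W⁽ᵈ⁾ᵀ Φ⁽ᵈ⁾) ∈ ℝ^{1×N}` satisfies
`‖1_Rᵀ (⊛_d W⁽ᵈ⁾ᵀ Φ⁽ᵈ⁾)‖²_F
  = 1_Nᵀ (⊛_{d=1}^D (Φ⁽ᵈ⁾ ⊙ Φ⁽ᵈ⁾)ᵀ (W⁽ᵈ⁾ ⊗ W⁽ᵈ⁾)) 1_{R²}`,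
the right-hand Hadamard product combining `D` matrices of size `N×R²`. -/
theorem sq_frobenius_norm_hadamard_identity
    {D N R : ℕ} {M : Fin D → ℕ}
    (W : (d : Fin D) → Matrix (Fin (M d)) (Fin R) ℝ)
    (Φ : (d : Fin D) → Matrix (Fin (M d)) (Fin N) ℝ) :
    ∑ n : Fin N, (∑ r : Fin R, ∏ d, ((W d)ᵀ * Φ d) r n) ^ 2
      = ∑ n : Fin N, ∑ q : Fin R × Fin R,
          ∏ d, ((khatriRao (Φ d) (Φ d))ᵀ * (W d ⊗ₖ W d)) n q := by
  refine Finset.sum_congr rfl fun n _ => ?_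
  simp only [khatriRao_transpose_mul_kronecker_apply, Finset.prod_mul_distrib,
    Fintype.sum_prod_type, sq, Fintype.sum_mul_sum]
end
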